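/- For every odd integer n > 3, the automaton ℬ_n is synchronizing and its reset length (the minimum length of a reset word) is exactly n² − 3n + 2. -/

import Mathlib

/-- The two input letters of the automaton. -/
inductive Letter | a | b

/-- Transition function of the automaton `ℬₙ` on states `{1, …, n}`:
`δ(i,a) = i` for `i < n-1`, `δ(n-1,a) = 1`, `δ(n,a) = 2`,
`δ(i,b) = i+1` for `i < n`, `δ(n,b) = 1`. -/
def delta (n : ℕ) (q : ℕ) : Letter → ℕ
  | Letter.a => if q < n - 1 then q else if q = n - 1 then 1 else 2
  | Letter.b => if q < n then q + 1 else 1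

/-- `w` is a reset word: it sends every state in `{1, …, n}` to one single state. -/
def IsReset (n : ℕ) (w : List Letter) : Prop :=
  ∃ p : ℕ, ∀ q ∈ Finset.Icc 1 n, w.foldl (delta n) q = p

/-- For each word `w` there is a constant `B` (its number of letters `b`) such that the run of `w`
from any state `q` makes some number `J` of jumps (moves by `a` that change the state), each worth
`+2` modulo `n`, and performing `J` jumps forces `w` to be long. -/
theorem exists_jump_count {n : ℕ} (hn : 3 < n) (w : List Letter) :
    ∃ B : ℕ, ∀ q, 1 ≤ q → q ≤ n → ∃ J : ℕ,
      1 ≤ w.foldl (delta n) q ∧ w.foldl (delta n) q ≤ n ∧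
      w.foldl (delta n) q + (n - 1) * J ≤ q + w.length ∧
      w.foldl (delta n) q ≡ q + B + 2 * J [MOD n] := by
  induction w using List.reverseRecOn with
  | nil => exact ⟨0, fun q h1 h2 => ⟨0, by simp [h1, h2, Nat.ModEq]⟩⟩
  | append_singleton w x ih =>
    obtain ⟨B, hB⟩ := ih
    cases x with
    | a =>
      refine ⟨B, fun q h1 h2 => ?_⟩
      obtain ⟨J, hp1, hp2, hlen, hmod⟩ := hB q h1 h2
      simp only [List.foldl_append, List.foldl_cons, List.foldl_nil, List.length_append,
        List.length_singleton]
      generalize w.foldl (delta n) q = p at *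
      by_cases hp : p < n - 1
      · exact ⟨J, by simp only [delta, if_pos hp]; omega, by simp only [delta, if_pos hp]; omega,
          by simp only [delta, if_pos hp]; omega, by simpa only [delta, if_pos hp] using hmod⟩
      · have hd : delta n p Letter.a + n = p + 2 := by
          simp only [delta, if_neg hp]; split_ifs <;> omega
        refine ⟨J + 1, by omega, by omega, by rw [mul_add]; omega, ?_⟩
        have h := hmod.add_right 2
        rw [← hd] at h
        simpa [Nat.ModEq, mul_add, add_assoc] using h
    | b =>
      refine ⟨B + 1, fun q h1 h2 => ?_⟩
      obtain ⟨J, hp1, hp2, hlen, hmod⟩ := hB q h1 h2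
      simp only [List.foldl_append, List.foldl_cons, List.foldl_nil, List.length_append,
        List.length_singleton]
      generalize w.foldl (delta n) q = p at *
      have h := hmod.add_right 1
      rw [show q + B + 2 * J + 1 = q + (B + 1) + 2 * J by ring] at h
      by_cases hp : p < n
      · exact ⟨J, by simp only [delta, if_pos hp]; omega, by simp only [delta, if_pos hp]; omega,
          by simp only [delta, if_pos hp]; omega, by simpa only [delta, if_pos hp] using h⟩
      · obtain rfl : p = n := by omega
        have hd : delta p p Letter.b = 1 := by simp [delta]
        refine ⟨J, by omega, by omega, by omega, ?_⟩
        rw [hd]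
        simpa [Nat.ModEq] using h

theorem length_of_isReset {n : ℕ} (hn : 3 < n) {w : List Letter} (hw : IsReset n w) :
    (n - 1) * (n - 2) ≤ w.length := by
  obtain ⟨p, hp⟩ := hw
  obtain ⟨B, hB⟩ := exists_jump_count hn w
  choose! J hJ using hB
  obtain ⟨q, hq, hqJ⟩ : ∃ q ∈ Finset.Icc 1 n, n - 1 ≤ J q := by
    by_contra! hlt
    obtain ⟨q, hq, r, hr, hne, heq⟩ := Finset.exists_ne_map_eq_of_card_lt_of_maps_to
      (s := Finset.Icc 1 n) (t := Finset.range (n - 1)) (f := J)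
      (by simp only [Nat.card_Icc, Finset.card_range]; omega)
      (fun q hq => by simpa using hlt q hq)
    have hq' := Finset.mem_Icc.1 hq
    have hr' := Finset.mem_Icc.1 hr
    have h1 := (hJ q hq'.1 hq'.2).2.2.2
    have h2 := (hJ r hr'.1 hr'.2).2.2.2
    rw [hp q hq] at h1
    rw [hp r hr, ← heq] at h2
    have h : q ≡ r [MOD n] := ((h1.symm.trans h2).add_right_cancel').add_right_cancel'
    rcases lt_or_gt_of_ne hne with hlt | hlt
    · have := Nat.le_of_dvd (by omega) ((Nat.modEq_iff_dvd' hlt.le).1 h)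
      omega
    · have := Nat.le_of_dvd (by omega) ((Nat.modEq_iff_dvd' hlt.le).1 h.symm)
      omega
  have hq' := Finset.mem_Icc.1 hq
  obtain ⟨h1, -, h3, -⟩ := hJ q hq'.1 hq'.2
  have hmul : (n - 1) * (n - 1) ≤ (n - 1) * J q := Nat.mul_le_mul_left _ hqJ
  obtain ⟨k, rfl⟩ : ∃ k, n = k + 2 := ⟨n - 2, by omega⟩
  simp only [Nat.add_sub_cancel, show k + 2 - 1 = k + 1 by omega] at *
  nlinarith

theorem foldl_replicate_b {n q k : ℕ} (hqn : q ≤ n) (hk : k ≤ n) :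
    (List.replicate k Letter.b).foldl (delta n) q = if q + k ≤ n then q + k else q + k - n := by
  induction k with
  | zero => simp [hqn]
  | succ k ih =>
    rw [List.replicate_succ', List.foldl_append, ih (by omega)]
    simp only [List.foldl_cons, List.foldl_nil, delta]
    split_ifs <;> omega

/-- The word `b ^ k a`. -/
def rotateFold (k : ℕ) : List Letter := List.replicate k Letter.b ++ [Letter.a]

theorem foldl_rotateFold {n q k : ℕ} (hqn : q ≤ n) (hk : k ≤ n) :
    (rotateFold k).foldl (delta n) q =
      delta n (if q + k ≤ n then q + k else q + k - n) Letter.a := by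
  rw [rotateFold, List.foldl_append, foldl_replicate_b hqn hk]
  rfl

/-- Iterating `b ^ (n - 2) a` lowers states in steps of two until they reach `1` or `2`. -/
theorem foldl_flatten_replicate_rotateFold {n : ℕ} (hn : 3 < n) (k : ℕ) {q : ℕ} (hq : 1 ≤ q)
    (hqn : q ≤ n - 2) :
    ∃ r, (List.replicate k (rotateFold (n - 2))).flatten.foldl (delta n) q = r ∧
      r % 2 = q % 2 ∧ 1 ≤ r ∧ (r ≤ 2 ∨ r + 2 * k ≤ q) := by
  induction k generalizing q with
  | zero => exact ⟨q, by simp, rfl, hq, by omega⟩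
  | succ k ih =>
    have hstep : (rotateFold (n - 2)).foldl (delta n) q = if q ≤ 2 then q else q - 2 := by
      rw [foldl_rotateFold (by omega) (by omega)]
      simp only [delta]
      split_ifs <;> omega
    rw [List.replicate_succ, List.flatten_cons, List.foldl_append, hstep]
    split_ifs with h
    · obtain ⟨r, hr, h1, h2, h3⟩ := ih hq hqn
      exact ⟨r, hr, h1, h2, by omega⟩
    · obtain ⟨r, hr, h1, h2, h3⟩ := ih (q := q - 2) (by omega) (by omega)
      exact ⟨r, hr, by omega, h2, by omega⟩

/-- The shortest reset word `a (b ^ (n - 2) a) ^ m b ^ (n - 3) a (b ^ (n - 2) a) ^ m`, where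
`n = 2 * m + 3`. -/
def shortestReset (n m : ℕ) : List Letter :=
  [Letter.a] ++ ((List.replicate m (rotateFold (n - 2))).flatten ++
    (rotateFold (n - 3) ++ (List.replicate m (rotateFold (n - 2))).flatten))

theorem isReset_shortestReset {m : ℕ} (hm : 1 ≤ m) :
    IsReset (2 * m + 3) (shortestReset (2 * m + 3) m) := by
  refine ⟨1, fun q hq => ?_⟩
  rw [Finset.mem_Icc] at hq
  simp only [shortestReset, List.foldl_append, List.foldl_cons, List.foldl_nil]
  have h0 : 1 ≤ delta (2 * m + 3) q Letter.a ∧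
      delta (2 * m + 3) q Letter.a ≤ 2 * m + 3 - 2 := by
    simp only [delta]
    split_ifs <;> omega
  obtain ⟨r, hr, -, hr1, hr2⟩ :=
    foldl_flatten_replicate_rotateFold (n := 2 * m + 3) (by omega) m h0.1 h0.2
  rw [hr, foldl_rotateFold (by omega) (by omega)]
  have hs : ∃ s, delta (2 * m + 3) (if r + (2 * m + 3 - 3) ≤ 2 * m + 3 then r + (2 * m + 3 - 3)
      else r + (2 * m + 3 - 3) - (2 * m + 3)) Letter.a = s ∧ (s = 2 * m + 1 ∨ s = 1) := by
    refine ⟨_, rfl, ?_⟩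
    simp only [delta]
    split_ifs <;> omega
  obtain ⟨s, hs, hs'⟩ := hs
  rw [hs]
  obtain ⟨t, ht, ht1, ht2, ht3⟩ :=
    foldl_flatten_replicate_rotateFold (n := 2 * m + 3) (by omega) m (q := s) (by omega) (by omega)
  rw [ht]
  omega

theorem length_shortestReset (m : ℕ) :
    (shortestReset (2 * m + 3) m).length = (2 * m + 2) * (2 * m + 1) := by
  simp [shortestReset, rotateFold, show 2 * m + 3 - 2 = 2 * m + 1 by omega]
  ring

/-- For every odd `n > 3`, the automaton `ℬₙ` is synchronizing and its reset length
is exactly `n² - 3n + 2`. -/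
theorem b_automaton_reset_length (n : ℕ) (hn : 3 < n) (hodd : Odd n) :
    IsLeast {L : ℕ | ∃ w : List Letter, IsReset n w ∧ w.length = L}
      (n ^ 2 - 3 * n + 2) := by
  obtain ⟨m, rfl⟩ : ∃ m, n = 2 * m + 3 := by
    obtain ⟨k, rfl⟩ := hodd
    exact ⟨k - 1, by omega⟩
  have hval : (2 * m + 3) ^ 2 - 3 * (2 * m + 3) + 2 = (2 * m + 2) * (2 * m + 1) := by
    rw [show (2 * m + 3) ^ 2 = 3 * (2 * m + 3) + 2 * m * (2 * m + 3) by ring,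
      Nat.add_sub_cancel_left]
    ring
  rw [hval]
  constructor
  · exact ⟨_, isReset_shortestReset (by omega), length_shortestReset m⟩
  · rintro L ⟨w, hw, rfl⟩
    exact length_of_isReset hn hw
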